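/- Under the 1D-FLP data, let k, t ≥ 1 with k * t ≤ N, and let C¹, …, Cᵗ be pairwise disjoint subsets of Fin N, each of cardinality k, such that for each l the restricted problem over Q₁(Cˡ) attains its minimum γ(Cˡ). Let ℐ be any family of linear inequalities, each of the form a·(c, d, z) ≥ β (where a is a linear functional on the variable space), such that (i) each inequality is valid for Q₁ (satisfied by every point of Q₁), and (ii) each inequality has support over some Cˡ, i.e. the linear functional a has nonzero coefficients only on the coordinates c i, d i j, z i j with i, j ∈ Cˡ for a single l ∈ {1, …, t}. Then there exists a point of Q₁ᴸᴾ satisfying every inequality in ℐ whose objective value f equals ∑_{l=1}^{t} γ(Cˡ); consequently, the infimum of f over Q₁ᴸᴾ intersected with the solution set of ℐ is at most ∑_{l=1}^{t} γ(Cˡ), which itself is at most ω_k. -/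

import Mathlib

open Finset

/-- The weighted sum `∑_{i<j, i,j ∈ C} p i j * d i j` over pairs of indices in `C`. -/
noncomputable def pairObj {N : ℕ} (p d : Fin N → Fin N → ℝ) (C : Finset (Fin N)) : ℝ :=
  ∑ q ∈ (C ×ˢ C).filter (fun q => q.1 < q.2), p q.1 q.2 * d q.1 q.2

/-- Membership in the restricted 1D-FLP feasible set `Q₁(C)`; `Q₁ = Q₁(Finset.univ)`. -/
def Mem1D {N : ℕ} (ℓ : Fin N → ℝ) (L : ℝ) (C : Finset (Fin N))
    (c : Fin N → ℝ) (d z : Fin N → Fin N → ℝ) : Prop :=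
  (∀ i ∈ C, ∀ j ∈ C, i ≠ j → d i j = d j i) ∧
  (∀ i ∈ C, ∀ j ∈ C, i ≠ j → d i j ≥ c i - c j) ∧
  (∀ i ∈ C, ∀ j ∈ C, i ≠ j → c i + ℓ i ≤ c j - ℓ j + L * (1 - z i j)) ∧
  (∀ i ∈ C, ∀ j ∈ C, i ≠ j → z i j + z j i = 1) ∧
  (∀ i ∈ C, 0 ≤ c i ∧ c i ≤ L) ∧
  (∀ i ∈ C, ∀ j ∈ C, i ≠ j → z i j ∈ ({0, 1} : Set ℝ))

/-- `γ(C)`: the optimal (infimum) value of the 1D-FLP restricted to the components `C`. -/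
noncomputable def gamma1 {N : ℕ} (ℓ : Fin N → ℝ) (L : ℝ) (p : Fin N → Fin N → ℝ)
    (C : Finset (Fin N)) : ℝ :=
  sInf {v | ∃ c d z, Mem1D ℓ L C c d z ∧ v = pairObj p d C}

/-- `ω(𝒞)`: the combinatorial dual bound obtained from the family `𝒞`. -/
noncomputable def omega1 {N : ℕ} (ℓ : Fin N → ℝ) (L : ℝ) (p : Fin N → Fin N → ℝ)
    (𝒞 : Set (Finset (Fin N))) : ℝ :=
  sInf {v | ∃ d : Fin N → Fin N → ℝ,
    (∀ i j : Fin N, i ≠ j → d i j = d j i ∧ 0 ≤ d i j) ∧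
    (∀ C ∈ 𝒞, pairObj p d C ≥ gamma1 ℓ L p C) ∧
    v = pairObj p d Finset.univ}

/-- Membership in the LP relaxation `Q₁ᴸᴾ` of the 1D-FLP formulation. -/
def Mem1DLP {N : ℕ} (ℓ : Fin N → ℝ) (L : ℝ)
    (c : Fin N → ℝ) (d z : Fin N → Fin N → ℝ) : Prop :=
  (∀ i j : Fin N, i ≠ j → d i j = d j i) ∧
  (∀ i j : Fin N, i ≠ j → d i j ≥ c i - c j) ∧
  (∀ i j : Fin N, i ≠ j → c i + ℓ i ≤ c j - ℓ j + L * (1 - z i j)) ∧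
  (∀ i j : Fin N, i ≠ j → z i j + z j i = 1) ∧
  (∀ i : Fin N, 0 ≤ c i ∧ c i ≤ L) ∧
  (∀ i j : Fin N, i ≠ j → 0 ≤ z i j ∧ z i j ≤ 1)

/-- The left-hand side of the linear inequality indexed by `e`, evaluated at `(c, d, z)`. -/
noncomputable def ineqLHS {N : ℕ} {ι : Type*} (ac : ι → Fin N → ℝ)
    (ad az : ι → Fin N → Fin N → ℝ) (e : ι)
    (c : Fin N → ℝ) (d z : Fin N → Fin N → ℝ) : ℝ :=
  (∑ i, ac e i * c i) + (∑ i, ∑ j, ad e i j * d i j) + (∑ i, ∑ j, az e i j * z i j)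

/-- Disjoint intervals with centres `c a` and half-lengths `ℓ a`, all contained in `[x, y]`, have
total length at most `y - x`. -/
theorem two_mul_sum_le_of_separated {α : Type*} [DecidableEq α] (ℓ c : α → ℝ) (S : Finset α)
    (hsep : ∀ a ∈ S, ∀ b ∈ S, a ≠ b → c a ≤ c b → c a + ℓ a ≤ c b - ℓ b)
    {x y : ℝ} (hxy : x ≤ y) (hx : ∀ a ∈ S, x ≤ c a - ℓ a) (hy : ∀ a ∈ S, c a + ℓ a ≤ y) :
    2 * ∑ a ∈ S, ℓ a ≤ y - x := by
  induction S using Finset.induction_on_max_value c generalizing y with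
  | empty => simpa using hxy
  | insert m s hm hmax ih =>
    have h := ih (y := c m - ℓ m)
      (fun a ha b hb => hsep a (mem_insert_of_mem ha) b (mem_insert_of_mem hb))
      (hx m (mem_insert_self m s)) (fun a ha => hx a (mem_insert_of_mem ha))
      (fun a ha => hsep a (mem_insert_of_mem ha) m (mem_insert_self m s)
        (fun h => hm (h ▸ ha)) (hmax a ha))
    have hym := hy m (mem_insert_self m s)
    rw [sum_insert hm]
    linarith

/-- The layout that places components without gaps, starting at `0`, in increasing order of `g`. -/
noncomputable def packed {N : ℕ} (ℓ g : Fin N → ℝ) (i : Fin N) : ℝ :=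
  ℓ i + 2 * ∑ j with g j < g i, ℓ j

/-- The precedence variables of the order given by `g`. -/
noncomputable def precedence {N : ℕ} (g : Fin N → ℝ) (i j : Fin N) : ℝ :=
  if g i < g j then 1 else if g j < g i then 0 else 1 / 2

theorem precedence_add_swap {N : ℕ} (g : Fin N → ℝ) (i j : Fin N) :
    precedence g i j + precedence g j i = 1 := by
  unfold precedence
  split_ifs <;> linarith

theorem packed_sub_packed {N : ℕ} (ℓ g : Fin N → ℝ) {i j : Fin N} (hij : g i < g j) :
    packed ℓ g j - packed ℓ g i = ℓ j - ℓ i + 2 * ∑ k with g i ≤ g k ∧ g k < g j, ℓ k := by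
  have h := sum_filter_add_sum_filter_not (univ.filter fun k => g k < g j) (fun k => g k < g i) ℓ
  have h₁ : (univ.filter fun k => g k < g j).filter (fun k => g k < g i) =
      univ.filter fun k => g k < g i := by
    ext k
    simp only [mem_filter, mem_univ, true_and]
    exact ⟨And.right, fun h => ⟨h.trans hij, h⟩⟩
  have h₂ : (univ.filter fun k => g k < g j).filter (fun k => ¬ g k < g i) =
      univ.filter fun k => g i ≤ g k ∧ g k < g j := by
    ext k
    simp only [mem_filter, mem_univ, true_and, not_lt]
    exact and_comm
  rw [h₁, h₂] at h
  unfold packed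
  linarith

theorem packed_separated {N : ℕ} {ℓ g : Fin N → ℝ} (hℓ : ∀ i, 0 < ℓ i) {i j : Fin N}
    (hij : g i < g j) : packed ℓ g i + ℓ i ≤ packed ℓ g j - ℓ j := by
  have h : ℓ i ≤ ∑ k with g i ≤ g k ∧ g k < g j, ℓ k :=
    single_le_sum (f := ℓ) (fun k _ => (hℓ k).le) (by simpa using hij)
  linarith [packed_sub_packed ℓ g hij]

theorem le_packed {N : ℕ} {ℓ : Fin N → ℝ} (g : Fin N → ℝ) (hℓ : ∀ i, 0 < ℓ i) (i : Fin N) :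
    ℓ i ≤ packed ℓ g i := by
  have h : 0 ≤ ∑ j with g j < g i, ℓ j := sum_nonneg fun j _ => (hℓ j).le
  unfold packed
  linarith

theorem packed_le {N : ℕ} {ℓ : Fin N → ℝ} (g : Fin N → ℝ) (hℓ : ∀ i, 0 < ℓ i) {L : ℝ}
    (hL : L ≥ 2 * ∑ i, ℓ i) (i : Fin N) : packed ℓ g i ≤ L - ℓ i := by
  have hi : i ∉ univ.filter fun j => g j < g i := by simp
  have h : ∑ j ∈ insert i (univ.filter fun j => g j < g i), ℓ j ≤ ∑ j, ℓ j :=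
    sum_le_sum_of_subset_of_nonneg (subset_univ _) fun j _ _ => (hℓ j).le
  rw [sum_insert hi] at h
  unfold packed
  linarith

theorem mem1D_packed {N : ℕ} {ℓ g : Fin N → ℝ} {L : ℝ} {d : Fin N → Fin N → ℝ}
    (hℓ : ∀ i, 0 < ℓ i) (hL : L ≥ 2 * ∑ i, ℓ i) (hg : Function.Injective g)
    (hsymm : ∀ i j, i ≠ j → d i j = d j i)
    (hd : ∀ i j, i ≠ j → packed ℓ g i - packed ℓ g j ≤ d i j) :
    Mem1D ℓ L univ (packed ℓ g) d (precedence g) := by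
  refine ⟨fun i _ j _ => hsymm i j, fun i _ j _ => hd i j, fun i _ j _ hij => ?_,
    fun i _ j _ _ => precedence_add_swap g i j, fun i _ => ?_, fun i _ j _ hij => ?_⟩
  · rcases lt_or_gt_of_ne (hg.ne hij) with h | h
    · simpa [precedence, h] using packed_separated hℓ h
    · have hi := packed_le g hℓ hL i
      have hj := le_packed g hℓ j
      simp only [precedence, h, h.not_gt, if_true, if_false]
      linarith
  · have hi := packed_le g hℓ hL i
    have hj := le_packed g hℓ i
    have := hℓ i
    constructor <;> linarith
  · rcases lt_or_gt_of_ne (hg.ne hij) with h | h <;> simp [precedence, h, h.not_gt]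

theorem Mem1D.separated {N : ℕ} {ℓ : Fin N → ℝ} {L : ℝ}
    {C : Finset (Fin N)} {c : Fin N → ℝ} {d z : Fin N → Fin N → ℝ} (h : Mem1D ℓ L C c d z)
    {i j : Fin N} (hi : i ∈ C) (hj : j ∈ C) (hij : i ≠ j) (hc : c i ≤ c j) :
    c i + ℓ i ≤ c j - ℓ j := by
  obtain ⟨-, -, hs, hz, -, hb⟩ := h
  have h₁ := hs i hi j hj hij
  have h₂ := hs j hj i hi hij.symm
  have h₃ := hz i hi j hj hij
  rcases hb i hi j hj hij with h₀ | h₀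
  · have h₄ : z j i = 1 := by linarith
    rw [h₄] at h₂
    linarith
  · rw [Set.mem_singleton_iff.mp h₀] at h₁
    linarith

theorem Mem1D.dist_nonneg {N : ℕ} {ℓ : Fin N → ℝ} {L : ℝ}
    {C : Finset (Fin N)} {c : Fin N → ℝ} {d z : Fin N → Fin N → ℝ} (h : Mem1D ℓ L C c d z)
    {i j : Fin N} (hi : i ∈ C) (hj : j ∈ C) (hij : i ≠ j) : 0 ≤ d i j := by
  have h₁ := h.1 i hi j hj hij
  have h₂ := h.2.1 i hi j hj hij
  have h₃ := h.2.1 j hj i hi hij.symm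
  linarith

theorem Mem1D.mono {N : ℕ} {ℓ : Fin N → ℝ} {L : ℝ} {C D : Finset (Fin N)} (hCD : C ⊆ D)
    {c : Fin N → ℝ} {d z : Fin N → Fin N → ℝ} (h : Mem1D ℓ L D c d z) : Mem1D ℓ L C c d z :=
  ⟨fun i hi j hj => h.1 i (hCD hi) j (hCD hj),
    fun i hi j hj => h.2.1 i (hCD hi) j (hCD hj),
    fun i hi j hj => h.2.2.1 i (hCD hi) j (hCD hj),
    fun i hi j hj => h.2.2.2.1 i (hCD hi) j (hCD hj),
    fun i hi => h.2.2.2.2.1 i (hCD hi),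
    fun i hi j hj => h.2.2.2.2.2 i (hCD hi) j (hCD hj)⟩

/-- Reflecting a layout about the middle of the floor preserves feasibility. -/
theorem Mem1D.reverse {N : ℕ} {ℓ : Fin N → ℝ} {L : ℝ}
    {C : Finset (Fin N)} {c : Fin N → ℝ} {d z : Fin N → Fin N → ℝ} (h : Mem1D ℓ L C c d z) :
    Mem1D ℓ L C (fun i => L - c i) d (fun i j => z j i) := by
  obtain ⟨hsymm, hd, hs, hz, hc, hb⟩ := h
  refine ⟨hsymm, fun i hi j hj hij => ?_, fun i hi j hj hij => ?_,
    fun i hi j hj hij => hz j hj i hi hij.symm, fun i hi => ?_,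
    fun i hi j hj hij => hb j hj i hi hij.symm⟩
  · have h₁ := hd j hj i hi hij.symm
    rw [hsymm i hi j hj hij]
    linarith
  · have h₁ := hs j hj i hi hij.symm
    linarith
  · have h₁ := hc i hi
    constructor <;> linarith

/-- The distances of a feasible layout of `C` extend to a feasible layout of all components. -/
theorem Mem1D.exists_extension {N : ℕ} {ℓ : Fin N → ℝ} (hℓ : ∀ i, 0 < ℓ i) {L : ℝ}
    (hL : L ≥ 2 * ∑ i, ℓ i) {C : Finset (Fin N)} {c : Fin N → ℝ} {d z : Fin N → Fin N → ℝ}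
    (h : Mem1D ℓ L C c d z) :
    ∃ c' d' z', Mem1D ℓ L univ c' d' z' ∧ (∀ i ∈ C, ∀ j ∈ C, d' i j = d i j) ∧
      ∀ i j, z' i j + z' j i = 1 := by
  let g : Fin N → ℝ := fun i => if i ∈ C then c i else L + 1 + (i : ℕ)
  have hgC : ∀ i ∈ C, g i = c i := fun i hi => if_pos hi
  have hgC' : ∀ i ∉ C, g i = L + 1 + (i : ℕ) := fun i hi => if_neg hi
  have hcL : ∀ i ∈ C, c i ≤ L := fun i hi => (h.2.2.2.2.1 i hi).2
  have hgt : ∀ i ∉ C, L < g i := fun i hi => by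
    have : (0 : ℝ) ≤ (i : ℕ) := Nat.cast_nonneg _
    rw [hgC' i hi]
    linarith
  have hg : Function.Injective g := by
    intro i j hij
    by_cases hi : i ∈ C <;> by_cases hj : j ∈ C
    · by_contra hne
      rw [hgC i hi, hgC j hj] at hij
      linarith [h.separated hi hj hne hij.le, hℓ i, hℓ j]
    · linarith [hgC i hi, hcL i hi, hgt j hj]
    · linarith [hgC j hj, hcL j hj, hgt i hi]
    · rw [hgC' i hi, hgC' j hj] at hij
      exact Fin.ext (Nat.cast_injective (add_left_cancel hij))
  have hpack : ∀ i ∈ C, ∀ j ∈ C, i ≠ j → packed ℓ g i - packed ℓ g j ≤ d i j := by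
    intro i hi j hj hij
    rcases lt_or_gt_of_ne (hg.ne hij) with hlt | hlt
    · linarith [packed_separated hℓ hlt, hℓ i, hℓ j, h.dist_nonneg hi hj hij]
    · have hmem : ∀ a ∈ univ.filter (fun k => g j ≤ g k ∧ g k < g i),
          a ∈ C ∧ c j ≤ c a ∧ c a < c i := by
        intro a ha
        obtain ⟨h₁, h₂⟩ := (mem_filter.mp ha).2
        have haC : a ∈ C := by
          by_contra haC
          linarith [hgt a haC, hgC i hi, hcL i hi]
        rw [hgC a haC, hgC j hj] at h₁
        rw [hgC a haC, hgC i hi] at h₂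
        exact ⟨haC, h₁, h₂⟩
      rw [hgC i hi, hgC j hj] at hlt
      have hsum := two_mul_sum_le_of_separated ℓ c
        (univ.filter (fun k => g j ≤ g k ∧ g k < g i)) (x := c j - ℓ j) (y := c i - ℓ i)
        (fun a ha b hb hab hle => h.separated (hmem a ha).1 (hmem b hb).1 hab hle)
        (by linarith [h.separated hj hi hij.symm hlt.le, hℓ j])
        (fun a ha => by
          obtain ⟨haC, h₁, -⟩ := hmem a ha
          by_cases hja : j = a
          · rw [hja]
          · linarith [h.separated hj haC hja h₁, hℓ j])
        (fun a ha => by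
          obtain ⟨haC, -, h₂⟩ := hmem a ha
          exact h.separated haC hi (fun he => h₂.ne (he ▸ rfl)) h₂.le)
      rw [← hgC i hi, ← hgC j hj] at hlt
      have hd := h.2.1 i hi j hj hij
      linarith [packed_sub_packed ℓ g hlt]
  refine ⟨packed ℓ g, fun i j => if i ∈ C ∧ j ∈ C then d i j else |packed ℓ g i - packed ℓ g j|,
    precedence g, mem1D_packed hℓ hL hg (fun i j hij => ?_) (fun i j hij => ?_),
    fun i hi j hj => if_pos ⟨hi, hj⟩, precedence_add_swap g⟩
  · by_cases hC : i ∈ C ∧ j ∈ C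
    · simpa [hC] using h.1 i hC.1 j hC.2 hij
    · simp only [hC, and_comm.not.mp hC, if_false, abs_sub_comm]
  · by_cases hC : i ∈ C ∧ j ∈ C
    · simpa [hC] using hpack i hC.1 j hC.2 hij
    · simpa only [hC, if_false] using le_abs_self _

/-- An inequality supported on `C` and valid for the 1D-FLP holds at the fully symmetric point whose
distances over `C` come from a feasible layout of `C`. -/
theorem le_ineqLHS_midpoint {N : ℕ} {ℓ : Fin N → ℝ} (hℓ : ∀ i, 0 < ℓ i) {L : ℝ}
    (hL : L ≥ 2 * ∑ i, ℓ i) {C : Finset (Fin N)} {c : Fin N → ℝ} {d z D : Fin N → Fin N → ℝ}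
    (h : Mem1D ℓ L C c d z) (hD : ∀ i ∈ C, ∀ j ∈ C, D i j = d i j)
    {ι : Type*} {ac : ι → Fin N → ℝ} {ad az : ι → Fin N → Fin N → ℝ} {b : ℝ} {e : ι}
    (hvalid : ∀ c d z, Mem1D ℓ L univ c d z → ineqLHS ac ad az e c d z ≥ b)
    (hsupp : ∀ i j, ad e i j ≠ 0 → i ∈ C ∧ j ∈ C) :
    b ≤ ineqLHS ac ad az e (fun _ => L / 2) D (fun _ _ => 1 / 2) := by
  obtain ⟨c', d', z', hmem, hd, hz⟩ := h.exists_extension hℓ hL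
  have h₁ := hvalid _ _ _ hmem
  have h₂ := hvalid _ _ _ hmem.reverse
  have hc : 2 * ∑ i, ac e i * (L / 2) =
      (∑ i, ac e i * c' i) + ∑ i, ac e i * (L - c' i) := by
    rw [← sum_add_distrib, mul_sum]
    exact sum_congr rfl fun i _ => by ring
  have hdist : ∑ i, ∑ j, ad e i j * D i j = ∑ i, ∑ j, ad e i j * d' i j := by
    refine sum_congr rfl fun i _ => sum_congr rfl fun j _ => ?_
    by_cases h₀ : ad e i j = 0
    · simp [h₀]
    · obtain ⟨hi, hj⟩ := hsupp i j h₀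
      rw [hD i hi j hj, hd i hi j hj]
  have hprec : 2 * ∑ i, ∑ j, az e i j * (1 / 2 : ℝ) =
      (∑ i, ∑ j, az e i j * z' i j) + ∑ i, ∑ j, az e i j * z' j i := by
    simp_rw [← sum_add_distrib, mul_sum]
    refine sum_congr rfl fun i _ => sum_congr rfl fun j _ => ?_
    rw [← mul_add, hz i j]
    ring
  unfold ineqLHS at h₁ h₂ ⊢
  linarith

theorem pairObj_nonneg {N : ℕ} {p d : Fin N → Fin N → ℝ} (hp : ∀ i j, 0 ≤ p i j)
    {C : Finset (Fin N)} (hd : ∀ i ∈ C, ∀ j ∈ C, i ≠ j → 0 ≤ d i j) : 0 ≤ pairObj p d C := by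
  refine sum_nonneg fun q hq => ?_
  simp only [mem_filter, mem_product] at hq
  exact mul_nonneg (hp _ _) (hd _ hq.1.1 _ hq.1.2 hq.2.ne)

theorem gamma1_le_pairObj {N : ℕ} {ℓ : Fin N → ℝ} {L : ℝ} {p : Fin N → Fin N → ℝ}
    (hp : ∀ i j, 0 ≤ p i j) {C : Finset (Fin N)} {c : Fin N → ℝ} {d z : Fin N → Fin N → ℝ}
    (h : Mem1D ℓ L C c d z) : gamma1 ℓ L p C ≤ pairObj p d C := by
  refine csInf_le ⟨0, ?_⟩ ⟨c, d, z, h, rfl⟩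
  rintro v ⟨c, d, z, h, rfl⟩
  exact pairObj_nonneg hp fun i hi j hj => h.dist_nonneg hi hj

/-- The distances equal to `d l` within each block `C l` and to zero between different blocks. -/
noncomputable def blockDist {N t : ℕ} (C : Fin t → Finset (Fin N))
    (d : Fin t → Fin N → Fin N → ℝ) (i j : Fin N) : ℝ :=
  ∑ l, if i ∈ C l ∧ j ∈ C l then d l i j else 0

theorem blockDist_of_mem {N t : ℕ} {C : Fin t → Finset (Fin N)}
    (hdisj : ∀ l m, l ≠ m → Disjoint (C l) (C m)) (d : Fin t → Fin N → Fin N → ℝ)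
    {l : Fin t} {i j : Fin N} (hi : i ∈ C l) (hj : j ∈ C l) : blockDist C d i j = d l i j := by
  unfold blockDist
  rw [sum_eq_single l (fun m _ hm => if_neg fun h => ?_) (fun h => absurd (mem_univ l) h),
    if_pos ⟨hi, hj⟩]
  exact disjoint_left.mp (hdisj m l hm) h.1 hi

theorem pairObj_blockDist {N t : ℕ} (p : Fin N → Fin N → ℝ) (C : Fin t → Finset (Fin N))
    (d : Fin t → Fin N → Fin N → ℝ) :
    pairObj p (blockDist C d) univ = ∑ l, pairObj p (d l) (C l) := by
  unfold pairObj blockDist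
  simp_rw [mul_sum]
  rw [sum_comm]
  refine sum_congr rfl fun l _ => ?_
  simp_rw [mul_ite, mul_zero]
  rw [← sum_filter, filter_filter]
  refine sum_congr ?_ fun _ _ => rfl
  ext q
  simp only [mem_filter, mem_product, mem_univ, true_and]
  exact and_comm

theorem sum_pairObj_le {N t : ℕ} {p d : Fin N → Fin N → ℝ} (hp : ∀ i j, 0 ≤ p i j)
    (hd : ∀ i j, i ≠ j → 0 ≤ d i j) {C : Fin t → Finset (Fin N)}
    (hdisj : ∀ l m, l ≠ m → Disjoint (C l) (C m)) :
    ∑ l, pairObj p d (C l) ≤ pairObj p d univ := by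
  rw [← pairObj_blockDist p C fun _ => d]
  refine sum_le_sum fun q hq => mul_le_mul_of_nonneg_left ?_ (hp _ _)
  by_cases h : ∃ l, q.1 ∈ C l ∧ q.2 ∈ C l
  · obtain ⟨l, h₁, h₂⟩ := h
    exact (blockDist_of_mem hdisj (fun _ => d) h₁ h₂).le
  · have h₀ : blockDist C (fun _ => d) q.1 q.2 = 0 :=
      sum_eq_zero fun l _ => if_neg fun hl => h ⟨l, hl⟩
    rw [h₀]
    exact hd _ _ (mem_filter.mp hq).2.ne

theorem mem1DLP_midpoint {N : ℕ} {ℓ : Fin N → ℝ} (hℓ : ∀ i, 0 < ℓ i) {L : ℝ}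
    (hL : L ≥ 2 * ∑ i, ℓ i) {d : Fin N → Fin N → ℝ} (hsymm : ∀ i j, i ≠ j → d i j = d j i)
    (hd : ∀ i j, i ≠ j → 0 ≤ d i j) :
    Mem1DLP ℓ L (fun _ => L / 2) d (fun _ _ => 1 / 2) := by
  have hL₀ : 0 ≤ L := le_trans (mul_nonneg zero_le_two (sum_nonneg fun i _ => (hℓ i).le)) hL
  refine ⟨hsymm, fun i j hij => by simpa using hd i j hij, fun i j hij => ?_,
    fun _ _ _ => by norm_num, fun _ => ⟨by linarith, by linarith⟩, fun _ _ _ => by norm_num⟩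
  have h : ∑ a ∈ {i, j}, ℓ a ≤ ∑ a, ℓ a :=
    sum_le_sum_of_subset_of_nonneg (subset_univ _) fun a _ _ => (hℓ a).le
  rw [sum_pair hij] at h
  linarith

/-- Proposition 4.1: sparse valid inequalities supported on pairwise disjoint
variable sets cannot improve the LP bound beyond the combinatorial bound `ω_k`. -/
theorem sparse_cuts_cannot_beat_omega_k {N : ℕ} (hN : 2 ≤ N)
    (ℓ : Fin N → ℝ) (hℓ : ∀ i, 0 < ℓ i)
    (p : Fin N → Fin N → ℝ) (hpsym : ∀ i j, p i j = p j i)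
    (hpnn : ∀ i j, 0 ≤ p i j) (hpdiag : ∀ i, p i i = 0)
    (L : ℝ) (hL : L ≥ 2 * ∑ i, ℓ i)
    (k t : ℕ) (hk : 1 ≤ k) (ht : 1 ≤ t) (hkt : k * t ≤ N)
    (C : Fin t → Finset (Fin N)) (hcard : ∀ l, (C l).card = k)
    (hdisj : ∀ l m, l ≠ m → Disjoint (C l) (C m))
    (hattain : ∀ l, ∃ c d z, Mem1D ℓ L (C l) c d z ∧
      pairObj p d (C l) = gamma1 ℓ L p (C l))
    {ι : Type*} (ac : ι → Fin N → ℝ) (ad az : ι → Fin N → Fin N → ℝ) (β : ι → ℝ)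
    (hvalid : ∀ e, ∀ c d z, Mem1D ℓ L Finset.univ c d z →
      ineqLHS ac ad az e c d z ≥ β e)
    (hsupp : ∀ e, ∃ l, (∀ i, ac e i ≠ 0 → i ∈ C l) ∧
      (∀ i j, ad e i j ≠ 0 → i ∈ C l ∧ j ∈ C l) ∧
      (∀ i j, az e i j ≠ 0 → i ∈ C l ∧ j ∈ C l)) :
    (∃ c d z, Mem1DLP ℓ L c d z ∧ (∀ e, ineqLHS ac ad az e c d z ≥ β e) ∧
      pairObj p d Finset.univ = ∑ l, gamma1 ℓ L p (C l)) ∧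
    sInf {v | ∃ c d z, Mem1DLP ℓ L c d z ∧ (∀ e, ineqLHS ac ad az e c d z ≥ β e) ∧
        v = pairObj p d Finset.univ} ≤ ∑ l, gamma1 ℓ L p (C l) ∧
    ∑ l, gamma1 ℓ L p (C l) ≤ omega1 ℓ L p {C' : Finset (Fin N) | C'.card ≤ k} := by
  choose c d z hmem hopt using hattain
  have hsymm : ∀ i j, i ≠ j → blockDist C d i j = blockDist C d j i := by
    refine fun i j hij => sum_congr rfl fun l _ => ?_
    by_cases h : i ∈ C l ∧ j ∈ C l
    · simpa [h] using (hmem l).1 i h.1 j h.2 hij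
    · rw [if_neg h, if_neg (and_comm.not.mp h)]
  have hnonneg : ∀ i j, i ≠ j → 0 ≤ blockDist C d i j := by
    refine fun i j hij => sum_nonneg fun l _ => ?_
    split_ifs with h
    · exact (hmem l).dist_nonneg h.1 h.2 hij
    · exact le_rfl
  have hpoint : ∃ c d z, Mem1DLP ℓ L c d z ∧ (∀ e, ineqLHS ac ad az e c d z ≥ β e) ∧
      pairObj p d Finset.univ = ∑ l, gamma1 ℓ L p (C l) := by
    refine ⟨_, blockDist C d, _, mem1DLP_midpoint hℓ hL hsymm hnonneg, fun e => ?_, ?_⟩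
    · obtain ⟨l, -, hl, -⟩ := hsupp e
      exact le_ineqLHS_midpoint hℓ hL (hmem l)
        (fun i hi j hj => blockDist_of_mem hdisj d hi hj) (hvalid e) hl
    · rw [pairObj_blockDist]
      exact sum_congr rfl fun l _ => hopt l
  refine ⟨hpoint, ?_, ?_⟩
  · obtain ⟨c', d', z', hLP, hineq, hval⟩ := hpoint
    refine csInf_le ⟨0, ?_⟩ ⟨c', d', z', hLP, hineq, hval.symm⟩
    rintro v ⟨c, d, z, ⟨hs, hd, -⟩, -, rfl⟩
    refine pairObj_nonneg hpnn fun i _ j _ hij => ?_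
    linarith [hs i j hij, hd i j hij, hd j i hij.symm]
  · refine le_csInf ?_ ?_
    · have hempty : Mem1D ℓ L ∅ 0 0 0 := by simp [Mem1D]
      obtain ⟨c', d', z', h, -⟩ := hempty.exists_extension hℓ hL
      exact ⟨_, d', fun i j hij => ⟨h.1 i (mem_univ i) j (mem_univ j) hij,
        h.dist_nonneg (mem_univ i) (mem_univ j) hij⟩,
        fun D _ => gamma1_le_pairObj hpnn (h.mono (subset_univ D)), rfl⟩
    · rintro v ⟨d', hd, hfeas, rfl⟩
      exact (sum_le_sum fun l _ => hfeas (C l) (hcard l).le).trans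
        (sum_pairObj_le hpnn (fun i j hij => (hd i j hij).2) hdisj)
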